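/- Let Q be a ground Horn program. If there is a sequence of steps of the goal-stack machine for Q from the state [h] to the empty state [], then the atom h is derivable in Q. More generally, if there is a sequence of steps from a state G to [], then every atom occurring in G is derivable in Q. -/

import Mathlib

/-- A ground atom: a predicate symbol together with an argument tuple. -/
abbrev GAtom (P A : Type) := P × A

/-- A ground Horn rule: a head atom together with a finite list of body atoms. -/
abbrev GRule (P A : Type) := GAtom P A × List (GAtom P A)

/-- An atom is derivable in a ground Horn program `Q` if it is the head of a rule of
`Q` all of whose body atoms are derivable. -/
inductive Derivable {P A : Type} (Q : Set (GRule P A)) : GAtom P A → Prop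
  | intro (r : GRule P A) (hr : r ∈ Q) (hb : ∀ b ∈ r.2, Derivable Q b) :
      Derivable Q r.1

/-- A step of the goal-stack machine for `Q`: from a state `h :: G`, for any rule
`(h, B) ∈ Q` and any permutation `B'` of `B`, it may step to the state `B' ++ G`. -/
inductive Step {P A : Type} (Q : Set (GRule P A)) :
    List (GAtom P A) → List (GAtom P A) → Prop
  | mk (h : GAtom P A) (G B B' : List (GAtom P A)) :
      (h, B) ∈ Q → B.Perm B' → Step Q (h :: G) (B' ++ G)

/-- If there is a sequence of steps of the goal-stack machine for `Q` from the state
`[h]` to the empty state `[]`, then the atom `h` is derivable in `Q`.  More generally,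
if there is a sequence of steps from a state `G` to `[]`, then every atom occurring in
`G` is derivable in `Q`. -/
theorem derivable_of_goal_stack {P A : Type} (Q : Set (GRule P A)) :
    (∀ h : GAtom P A, Relation.ReflTransGen (Step Q) [h] [] → Derivable Q h) ∧
    (∀ G : List (GAtom P A), Relation.ReflTransGen (Step Q) G [] →
      ∀ a ∈ G, Derivable Q a) := by
  have key : ∀ G : List (GAtom P A), Relation.ReflTransGen (Step Q) G [] →
      ∀ a ∈ G, Derivable Q a := by
    intro G hG
    induction hG using Relation.ReflTransGen.head_induction_on with
    | refl => intro a ha; simp at ha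
    | head hstep _ ih =>
      cases hstep with
      | mk h G B B' hQ hp =>
        intro a ha
        rcases List.mem_cons.1 ha with rfl | ha
        · exact Derivable.intro (a, B) hQ
            (fun b hb => ih b (List.mem_append_left _ (hp.mem_iff.1 hb)))
        · exact ih a (List.mem_append_right _ ha)
  exact ⟨fun h hh => key [h] hh h (by simp), key⟩
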